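/- arXiv:2110.03957 — 2 statements merged into one kernel-verified Lean document; each statement's English description precedes it below -/
import Mathlib

section
/- If every connected component of a graph G contains at most one cycle, then the twin-width of G is at most 2. -/
/-- A trigraph: a finite vertex set together with disjoint symmetric sets of
black and red edges on distinct vertices. -/
structure Trigraph (V : Type*) where
  verts : Finset V
  Black : V → V → Prop
  Red : V → V → Prop
  black_symm : ∀ u v, Black u v → Black v u
  red_symm : ∀ u v, Red u v → Red v u
  black_ne : ∀ u v, Black u v → u ≠ v
  red_ne : ∀ u v, Red u v → u ≠ v
  black_red_disjoint : ∀ u v, ¬(Black u v ∧ Red u v)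
  black_mem : ∀ u v, Black u v → u ∈ verts
  red_mem : ∀ u v, Red u v → u ∈ verts

namespace Trigraph

variable {V : Type*}

/-- Two vertices are adjacent if they are joined by a black or a red edge. -/
def Adj (G : Trigraph V) (u v : V) : Prop := G.Black u v ∨ G.Red u v

/-- The red-degree of a vertex: the number of red edges incident with it. -/
noncomputable def redDeg (G : Trigraph V) (v : V) : ℕ := {w | G.Red v w}.ncard

/-- The degree of a vertex: the number of (black or red) edges incident with it. -/
noncomputable def deg (G : Trigraph V) (v : V) : ℕ := {w | G.Adj v w}.ncard

/-- Contraction of the two distinct vertices `u` and `v` of `G`; the new vertex is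
identified with `u`. A pair keeps a black edge to the new vertex iff it had black
edges to both `u` and `v`; it is non-adjacent iff it was non-adjacent to both;
otherwise it gets a red edge. -/
def contract [DecidableEq V] (G : Trigraph V) (u v : V) : Trigraph V where
  verts := G.verts.erase v
  Black x y := x ∈ G.verts.erase v ∧ y ∈ G.verts.erase v ∧ x ≠ y ∧
    ((x = u ∧ G.Black u y ∧ G.Black v y) ∨
     (y = u ∧ G.Black u x ∧ G.Black v x) ∨
     (x ≠ u ∧ y ≠ u ∧ G.Black x y))
  Red x y := x ∈ G.verts.erase v ∧ y ∈ G.verts.erase v ∧ x ≠ y ∧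
    ((x = u ∧ (G.Adj u y ∨ G.Adj v y) ∧ ¬(G.Black u y ∧ G.Black v y)) ∨
     (y = u ∧ (G.Adj u x ∨ G.Adj v x) ∧ ¬(G.Black u x ∧ G.Black v x)) ∨
     (x ≠ u ∧ y ≠ u ∧ G.Red x y))
  black_symm := by
    rintro x y ⟨hx, hy, hxy, h⟩
    refine ⟨hy, hx, hxy.symm, ?_⟩
    rcases h with h | h | ⟨h1, h2, h3⟩
    · exact Or.inr (Or.inl h)
    · exact Or.inl h
    · exact Or.inr (Or.inr ⟨h2, h1, G.black_symm _ _ h3⟩)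
  red_symm := by
    rintro x y ⟨hx, hy, hxy, h⟩
    refine ⟨hy, hx, hxy.symm, ?_⟩
    rcases h with h | h | ⟨h1, h2, h3⟩
    · exact Or.inr (Or.inl h)
    · exact Or.inl h
    · exact Or.inr (Or.inr ⟨h2, h1, G.red_symm _ _ h3⟩)
  black_ne := fun _ _ h => h.2.2.1
  red_ne := fun _ _ h => h.2.2.1
  black_red_disjoint := by
    rintro x y ⟨⟨hx, hy, hxy, hb⟩, ⟨_, _, _, hr⟩⟩
    rcases hb with ⟨hxu, hb1, hb2⟩ | ⟨hyu, hb1, hb2⟩ | ⟨hxu, hyu, hb⟩ <;>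
      rcases hr with ⟨hxu', hr1, hr2⟩ | ⟨hyu', hr1, hr2⟩ | ⟨hxu', hyu', hr⟩
    · exact hr2 ⟨hb1, hb2⟩
    · exact hxy (hxu.trans hyu'.symm)
    · exact hxu' hxu
    · exact hxy (hxu'.trans hyu.symm)
    · exact hr2 ⟨hb1, hb2⟩
    · exact hyu' hyu
    · exact hxu hxu'
    · exact hyu hyu'
    · exact G.black_red_disjoint x y ⟨hb, hr⟩
  black_mem := fun _ _ h => h.1
  red_mem := fun _ _ h => h.1

/-- `G.ValidSeq L` asserts that the list `L` of pairs of vertices describes a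
sequence of valid contractions starting from `G`: at each step, both vertices are
distinct vertices of the current trigraph, which are then contracted. -/
def ValidSeq [DecidableEq V] : Trigraph V → List (V × V) → Prop
  | _, [] => True
  | G, p :: L => p.1 ∈ G.verts ∧ p.2 ∈ G.verts ∧ p.1 ≠ p.2 ∧ ValidSeq (G.contract p.1 p.2) L

/-- The trigraph obtained after performing the contractions listed in `L`. -/
def applySeq [DecidableEq V] (G : Trigraph V) (L : List (V × V)) : Trigraph V :=
  L.foldl (fun H p => H.contract p.1 p.2) G

/-- The twin-width of a trigraph: the least `d` admitting a contraction sequence to a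
one-vertex trigraph in which every intermediate trigraph has maximum red-degree at most `d`. -/
noncomputable def tww [DecidableEq V] (G : Trigraph V) : ℕ :=
  sInf {d : ℕ | ∃ L : List (V × V), G.ValidSeq L ∧ (G.applySeq L).verts.card = 1 ∧
    ∀ L' : List (V × V), L' <+: L → ∀ v, (G.applySeq L').redDeg v ≤ d}

/-- The map induced by a partial contraction sequence, sending each vertex of the
initial trigraph to the vertex of the final trigraph into which it is contracted. -/
def seqMap [DecidableEq V] (L : List (V × V)) (x : V) : V :=
  L.foldl (fun y p => if y = p.2 then p.1 else y) x

/-- `δ_G(A)`: the set of edges of `G` with one end in `A` and the other end not in `A`. -/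
def cut (G : Trigraph V) (A : Set V) : Set (Sym2 V) :=
  {e | ∃ x y, e = s(x, y) ∧ G.Adj x y ∧ x ∈ A ∧ y ∉ A}

end Trigraph

/-- A simple graph viewed as a trigraph with all edges black and no red edges. -/
def SimpleGraph.toTrigraph {V : Type*} [Fintype V] (G : SimpleGraph V) : Trigraph V where
  verts := Finset.univ
  Black := G.Adj
  Red _ _ := False
  black_symm := fun _ _ h => h.symm
  red_symm := fun _ _ h => h.elim
  black_ne := fun _ _ h => h.ne
  red_ne := fun _ _ h => h.elim
  black_red_disjoint := fun _ _ h => h.2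
  black_mem := fun _ _ _ => Finset.mem_univ _
  red_mem := fun _ _ h => h.elim

/-- The twin-width of a simple graph. -/
noncomputable def SimpleGraph.tww {V : Type*} [Fintype V] [DecidableEq V]
    (G : SimpleGraph V) : ℕ :=
  G.toTrigraph.tww

namespace TwwAux
set_option linter.unusedSectionVars false
open Trigraph

variable {V : Type*} [DecidableEq V]

inductive Good : Trigraph V → Prop
  | done (G : Trigraph V) : G.verts.card = 1 → (∀ v, G.redDeg v ≤ 2) → Good G
  | step (G : Trigraph V) (u v : V) : u ∈ G.verts → v ∈ G.verts → u ≠ v →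
      (∀ v, G.redDeg v ≤ 2) → Good (G.contract u v) → Good G

theorem Good.exists_seq {G : Trigraph V} (h : Good G) :
    ∃ L : List (V × V), G.ValidSeq L ∧ (G.applySeq L).verts.card = 1 ∧
      ∀ L' : List (V × V), L' <+: L → ∀ v, (G.applySeq L').redDeg v ≤ 2 := by
  induction h with
  | done G h1 h2 =>
    refine ⟨[], trivial, h1, ?_⟩
    intro L' hL'
    rw [List.prefix_nil] at hL'
    subst hL'
    exact h2
  | step G u v hu hv huv h2 _ ih =>
    obtain ⟨L, hL, hc, hr⟩ := ih
    refine ⟨(u, v) :: L, ⟨hu, hv, huv, hL⟩, hc, ?_⟩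
    intro L' hL'
    cases L' with
    | nil => exact h2
    | cons p L' =>
      rw [List.cons_prefix_cons] at hL'
      obtain ⟨rfl, hL'⟩ := hL'
      exact hr L' hL'

theorem Good.tww_le {G : Trigraph V} (h : Good G) : G.tww ≤ 2 :=
  Nat.sInf_le h.exists_seq

theorem adj_symm {G : Trigraph V} {x y : V} (h : G.Adj x y) : G.Adj y x :=
  h.imp (G.black_symm _ _) (G.red_symm _ _)

theorem adj_ne {G : Trigraph V} {x y : V} (h : G.Adj x y) : x ≠ y :=
  h.elim (G.black_ne _ _) (G.red_ne _ _)

theorem adj_mem {G : Trigraph V} {x y : V} (h : G.Adj x y) : x ∈ G.verts :=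
  h.elim (G.black_mem _ _) (G.red_mem _ _)

theorem adj_mem' {G : Trigraph V} {x y : V} (h : G.Adj x y) : y ∈ G.verts :=
  adj_mem (adj_symm h)

theorem red_adj {G : Trigraph V} {x y : V} (h : G.Red x y) : G.Adj x y := Or.inr h

theorem contract_adj {G : Trigraph V} {u v x y : V} (h : (G.contract u v).Adj x y) :
    x ≠ v ∧ y ≠ v ∧ x ≠ y ∧
    ((x = u ∧ (G.Adj u y ∨ G.Adj v y)) ∨ (y = u ∧ (G.Adj u x ∨ G.Adj v x)) ∨
      (x ≠ u ∧ y ≠ u ∧ G.Adj x y)) := by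
  rcases h with ⟨h1, h2, h3, h4⟩ | ⟨h1, h2, h3, h4⟩
  all_goals
    refine ⟨(Finset.mem_erase.1 h1).1, (Finset.mem_erase.1 h2).1, h3, ?_⟩
    unfold Trigraph.Adj at *
    tauto

theorem contract_red {G : Trigraph V} {u v x y : V} (h : (G.contract u v).Red x y) :
    x ≠ v ∧ y ≠ v ∧ x ≠ y ∧
    ((x = u ∧ (G.Adj u y ∨ G.Adj v y) ∧ (G.Adj u y → G.Adj v y → G.Red u y ∨ G.Red v y)) ∨
     (y = u ∧ (G.Adj u x ∨ G.Adj v x) ∧ (G.Adj u x → G.Adj v x → G.Red u x ∨ G.Red v x)) ∨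
      (x ≠ u ∧ y ≠ u ∧ G.Red x y)) := by
  obtain ⟨h1, h2, h3, h4⟩ := h
  refine ⟨(Finset.mem_erase.1 h1).1, (Finset.mem_erase.1 h2).1, h3, ?_⟩
  have key : ∀ z, ¬(G.Black u z ∧ G.Black v z) → G.Adj u z → G.Adj v z →
      G.Red u z ∨ G.Red v z := by
    rintro z hz (h | h) (h' | h')
    · exact absurd ⟨h, h'⟩ hz
    · exact Or.inr h'
    · exact Or.inl h
    · exact Or.inl h
  rcases h4 with ⟨a, b, c⟩ | ⟨a, b, c⟩ | h4
  · exact Or.inl ⟨a, b, key _ c⟩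
  · exact Or.inr (Or.inl ⟨a, b, key _ c⟩)
  · exact Or.inr (Or.inr h4)

theorem contract_card {G : Trigraph V} {u v : V} (hv : v ∈ G.verts) :
    (G.contract u v).verts.card + 1 = G.verts.card :=
  Finset.card_erase_add_one hv

theorem ncard_le_two {s : Set V} (a b : V) (h : ∀ y ∈ s, y = a ∨ y = b) : s.ncard ≤ 2 :=
  (Set.ncard_le_ncard (t := {a, b}) (fun y hy => h y hy) (Set.toFinite _)).trans
    ((Set.ncard_insert_le a {b}).trans (by simp))

theorem exists_of_ncard_le_two [Finite V] {s : Set V} (h : s.ncard ≤ 2) {a b c : V}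
    (ha : a ∈ s) (hb : b ∈ s) (hc : c ∈ s) : a = b ∨ a = c ∨ b = c := by
  by_contra hh
  push Not at hh
  have : ({a, b, c} : Set V).ncard = 3 :=
    Set.ncard_eq_three.2 ⟨a, b, c, hh.1, hh.2.1, hh.2.2, rfl⟩
  have h2 : ({a, b, c} : Set V).ncard ≤ s.ncard :=
    Set.ncard_le_ncard (by rintro x (rfl | rfl | rfl) <;> assumption) (Set.toFinite _)
  omega

/-- Three-element version of having at most two neighbours. -/
def Le2 (P : V → Prop) : Prop := ∀ a b c, P a → P b → P c → a = b ∨ a = c ∨ b = c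

theorem Le2.ncard [Finite V] {P : V → Prop} (h : Le2 P) : {y | P y}.ncard ≤ 2 := by
  by_contra hh
  push Not at hh
  obtain ⟨t, ht, hc⟩ := Set.exists_subset_card_eq (s := {y | P y}) (n := 3) hh
  obtain ⟨a, b, c, h1, h2, h3, rfl⟩ := Set.ncard_eq_three.1 hc
  have := h a b c (ht (by simp)) (ht (by simp)) (ht (by simp))
  tauto

theorem redDeg_iff [Finite V] {G : Trigraph V} {v : V} : G.redDeg v ≤ 2 ↔ Le2 (G.Red v) :=
  ⟨fun h _ _ _ ha hb hc => exists_of_ncard_le_two h ha hb hc, Le2.ncard⟩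

/-! Phase C: the underlying graph has maximum degree at most two. -/

theorem phaseC [Finite V] (n : ℕ) : ∀ G : Trigraph V, G.verts.card = n + 1 →
    (∀ x, Le2 (G.Adj x)) → Good G := by
  induction n with
  | zero =>
    intro G hG hd
    exact Good.done G hG fun v => redDeg_iff.2 fun a b c ha hb hc =>
      hd v a b c (red_adj ha) (red_adj hb) (red_adj hc)
  | succ n ih =>
    intro G hG hd
    have hr : ∀ v, G.redDeg v ≤ 2 := fun v => redDeg_iff.2 fun a b c ha hb hc =>
      hd v a b c (red_adj ha) (red_adj hb) (red_adj hc)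
    by_cases he : ∃ u v, G.Adj u v
    · obtain ⟨u, v, huv⟩ := he
      refine Good.step G u v (adj_mem huv) (adj_mem' huv) (adj_ne huv) hr (ih _ ?_ ?_)
      · have := contract_card (G := G) (u := u) (adj_mem' huv); omega
      · intro x a b c ha hb hc
        have hvu := adj_symm huv
        replace ha := contract_adj ha
        replace hb := contract_adj hb
        replace hc := contract_adj hc
        by_cases hx : x = u
        · subst hx
          have k1 := hd x v
          have k2 := hd v x
          unfold Le2 at *
          grind
        · have e : ∀ {z}, G.Adj u z → G.Adj z u := adj_symm
          have e' : ∀ {z}, G.Adj v z → G.Adj z v := adj_symm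
          have k := hd x
          have f : ∀ z, (x ≠ v ∧ z ≠ v ∧ x ≠ z ∧
              ((x = u ∧ (G.Adj u z ∨ G.Adj v z)) ∨ (z = u ∧ (G.Adj u x ∨ G.Adj v x)) ∨
              (x ≠ u ∧ z ≠ u ∧ G.Adj x z))) →
              ∃ z', G.Adj x z' ∧ z = if z' = v then u else z' := by
            rintro z ⟨h1, h2, h3, h | h | h⟩
            · exact absurd h.1 hx
            · obtain ⟨rfl, h | h⟩ := h
              · exact ⟨z, e h, by simp⟩
              · exact ⟨v, e' h, by simp⟩
            · exact ⟨z, h.2.2, by simp [h2]⟩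
          obtain ⟨a', ha', rfl⟩ := f a ha
          obtain ⟨b', hb', rfl⟩ := f b hb
          obtain ⟨c', hc', rfl⟩ := f c hc
          rcases k a' b' c' ha' hb' hc' with h | h | h <;> simp [h]
    · push Not at he
      obtain ⟨u, hu, v, hv, huv⟩ := Finset.one_lt_card.1 (by omega : 1 < G.verts.card)
      refine Good.step G u v hu hv huv hr (ih _ ?_ ?_)
      · have := contract_card (G := G) (u := u) hv; omega
      · intro x a b c ha hb hc
        replace ha := contract_adj ha
        grind

/-! Phase B -/

structure InvB (G : Trigraph V) (C : Finset V) (f : V → V) : Prop where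
  maps : ∀ v ∈ C, f v ∈ C
  inj : ∀ u ∈ C, ∀ v ∈ C, f u = f v → u = v
  surj : ∀ v ∈ C, ∃ u ∈ C, f u = v
  nofix : ∀ v ∈ C, f v ≠ v
  adjC : ∀ x y, x ∈ C → y ∈ C → G.Adj x y → f x = y ∨ f y = x
  adjO : ∀ x y, x ∉ C → y ∉ C → ¬ G.Adj x y
  leaf1 : ∀ l x y, l ∉ C → G.Adj l x → G.Adj l y → x = y
  leaf2 : ∀ v a b, v ∈ C → a ∉ C → b ∉ C → G.Adj v a → G.Adj v b → a = b
  black : ∀ v l, v ∈ C → l ∉ C → G.Adj v l → ¬ G.Red v (f v)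

theorem InvB.red [Finite V] {G : Trigraph V} {C : Finset V} {f : V → V} (h : InvB G C f) (v : V) :
    G.redDeg v ≤ 2 := by
  obtain ⟨h1, h2, h3, h4, h5, h6, h7, h8, h9⟩ := h
  rw [redDeg_iff]
  intro a b c ha hb hc
  have ha' := red_adj ha
  have hb' := red_adj hb
  have hc' := red_adj hc
  by_cases hv : v ∈ C
  · have k : ∀ z, G.Adj v z → G.Red v z → (z = f v ∧ ∀ l, l ∉ C → ¬ G.Adj v l) ∨
        (z ∈ C ∧ f z = v) ∨ (z ∉ C) := by
      intro z hz hr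
      by_cases hzC : z ∈ C
      · rcases h5 v z hv hzC hz with h | h
        · subst h
          exact Or.inl ⟨rfl, fun l hl hvl => h9 v l hv hl hvl hr⟩
        · exact Or.inr (Or.inl ⟨hzC, h⟩)
      · exact Or.inr (Or.inr hzC)
    have ka := k a ha' ha
    have kb := k b hb' hb
    have kc := k c hc' hc
    grind
  · exact Or.inl (h7 v a b hv ha' hb')

theorem phaseB [Finite V] (n : ℕ) : ∀ G : Trigraph V, G.verts.card = n + 1 →
    ∀ C f, InvB G C f → Good G := by
  induction n using Nat.strong_induction_on with
  | _ n ih =>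
    intro G hG C f hI
    have hr := hI.red
    obtain ⟨h1, h2, h3, h4, h5, h6, h7, h8, h9⟩ := id hI
    by_cases hl : ∃ v l, v ∈ C ∧ l ∉ C ∧ G.Adj v l
    · obtain ⟨v, l, hv, hl, hvl⟩ := hl
      have hlv := adj_symm hvl
      obtain ⟨u, hu, rfl⟩ := h3 v hv
      set v := f u with hvdef
      have huv : u ≠ v := (h4 u hu).symm
      by_cases hul : ∃ m, m ∉ C ∧ G.Adj u m
      · -- rule 2
        obtain ⟨m, hm, hum⟩ := hul
        have hmu := adj_symm hum
        have hml : m ≠ l := by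
          rintro rfl
          exact huv (h7 m _ _ hm hmu hlv)
        have c1 := contract_card (G := G) (u := m) (adj_mem hlv)
        set G1 := G.contract m l with hG1
        have hm1 : m ∈ G1.verts := Finset.mem_erase.2 ⟨hml, adj_mem hmu⟩
        have hv1 : v ∈ G1.verts := Finset.mem_erase.2 ⟨adj_ne hvl, adj_mem hvl⟩
        have hvm : v ≠ m := by rintro h; exact hm (h ▸ hv)
        have c2 := contract_card (G := G1) (u := v) hm1
        have c3 : 0 < (G1.contract v m).verts.card :=
          Finset.card_pos.2 ⟨v, Finset.mem_erase.2 ⟨hvm, hv1⟩⟩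
        have c4 : (G1.contract v m).verts.card = n - 2 + 1 := by omega
        have c5 : n - 2 < n := by omega
        have a1 : ∀ x y, G1.Adj x y → x ≠ l ∧ y ≠ l ∧ ((x = m ∧ (y = u ∨ y = v)) ∨
            (y = m ∧ (x = u ∨ x = v)) ∨ (x ≠ m ∧ y ≠ m ∧ G.Adj x y)) := by
          intro x y h
          have := contract_adj h
          grind
        have r1 : ∀ x y, G1.Red x y → x ≠ l ∧ y ≠ l ∧ ((x = m ∧ (y = u ∨ y = v)) ∨
            (y = m ∧ (x = u ∨ x = v)) ∨ (x ≠ m ∧ y ≠ m ∧ G.Red x y)) := by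
          intro x y h
          have := a1 x y (red_adj h)
          have := contract_red h
          grind
        refine Good.step G m l (adj_mem hmu) (adj_mem hlv) hml hr
          (Good.step G1 v m hv1 hm1 hvm ?_ (ih (n - 2) c5 _ c4 C f ?_))
        · intro x
          by_cases hxm : x = m
          · subst hxm
            refine ncard_le_two u v fun y hy => ?_
            have := r1 _ _ hy
            grind
          · by_cases hxu : x = u
            · subst hxu
              obtain ⟨p, hp, hpx⟩ := h3 x hu
              refine ncard_le_two p m fun y hy => ?_
              have k := r1 _ _ hy
              by_cases hy : G.Red x y
              · have := red_adj hy
                grind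
              · grind
            · by_cases hxv : x = v
              · subst hxv
                refine ncard_le_two u m fun y hy => ?_
                have k := r1 _ _ hy
                by_cases hy : G.Red v y
                · have := red_adj hy
                  grind
                · grind
              · refine le_trans (Set.ncard_le_ncard ?_ (Set.toFinite _)) (hr x)
                intro y hy
                have := r1 _ _ hy
                grind
        · have a2 : ∀ x y, (G1.contract v m).Adj x y → x ≠ l ∧ y ≠ l ∧ x ≠ m ∧ y ≠ m ∧
              (G.Adj x y ∨ (x = u ∧ y = v) ∨ (x = v ∧ y = u)) := by
            intro x y h
            have k := contract_adj h
            have k1 := a1 x y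
            have k2 := a1 v y
            have k3 := a1 m y
            have k4 := a1 v x
            have k5 := a1 m x
            have k6 : G.Adj v x → G.Adj x v := adj_symm
            grind
          have r2 : ∀ x y, (G1.contract v m).Red x y → G.Red x y ∨ x = v ∨ y = v := by
            intro x y h
            have k := contract_red h
            have k1 := r1 x y
            grind
          refine ⟨h1, h2, h3, h4, ?_, ?_, ?_, ?_, ?_⟩
          · intro x y hx hy h
            have := a2 x y h
            grind
          · intro x y hx hy h
            have := a2 x y h
            grind
          · intro k x y hk hx hy
            have := a2 k x hx
            have := a2 k y hy
            grind
          · intro w a b hw ha hb hwa hwb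
            have := a2 w a hwa
            have := a2 w b hwb
            grind
          · intro w k hw hk hwk hred
            have := a2 w k hwk
            have := r2 _ _ hred
            grind
      · -- rule 1
        push Not at hul
        have c1 := contract_card (G := G) (u := v) (adj_mem hlv)
        refine Good.step G v l (adj_mem hvl) (adj_mem hlv) (adj_ne hvl) hr
          (ih (n - 1) ?_ _ ?_ C f ?_)
        · have := Finset.one_lt_card.2 ⟨v, adj_mem hvl, l, adj_mem hlv, adj_ne hvl⟩
          omega
        · have := Finset.one_lt_card.2 ⟨v, adj_mem hvl, l, adj_mem hlv, adj_ne hvl⟩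
          omega
        have a1 : ∀ x y, (G.contract v l).Adj x y → x ≠ l ∧ y ≠ l ∧ G.Adj x y := by
          intro x y h
          have := contract_adj h
          have : G.Adj v x → G.Adj x v := adj_symm
          grind
        have r1 : ∀ x y, (G.contract v l).Red x y → G.Red x y ∨ x = v ∨ y = v := by
          intro x y h
          have := contract_red h
          grind
        refine ⟨h1, h2, h3, h4, ?_, ?_, ?_, ?_, ?_⟩
        · intro x y hx hy h
          exact h5 x y hx hy (a1 x y h).2.2
        · intro x y hx hy h
          exact h6 x y hx hy (a1 x y h).2.2
        · intro k x y hk hx hy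
          exact h7 k x y hk (a1 _ _ hx).2.2 (a1 _ _ hy).2.2
        · intro w a b hw ha hb hwa hwb
          exact h8 w a b hw ha hb (a1 _ _ hwa).2.2 (a1 _ _ hwb).2.2
        · intro w k hw hk hwk hred
          have := a1 w k hwk
          have := r1 _ _ hred
          grind
    · push Not at hl
      refine phaseC n G hG ?_
      intro x a b c ha hb hc
      have hl' : ∀ z, G.Adj x z → x ∈ C ∧ z ∈ C := by
        intro z hz
        have := adj_symm hz
        have := hl x z
        have := hl z x
        have := h6 x z
        grind
      have k : ∀ z, G.Adj x z → z ∈ C ∧ (z = f x ∨ f z = x) := by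
        intro z hz
        have := hl' z hz
        have := h5 x z
        grind
      have := k a ha
      have := k b hb
      have := k c hc
      grind

/-! Phase A -/

def Lf (G : Trigraph V) (x : V) : Prop := ∀ y z, G.Adj x y → G.Adj x z → y = z

structure InvA (G : Trigraph V) (f : V → V) : Prop where
  adj : ∀ x y, G.Adj x y → f x = y ∨ f y = x
  red : ∀ x y, G.Red x y → Lf G x ∨ Lf G y
  deg : ∀ x, Le2 (G.Red x)

theorem phaseA_end [Finite V] {G : Trigraph V} {f : V → V} (hI : InvA G f)
    (hA : ∀ q a b, G.Adj q a → G.Adj q b → Lf G a → Lf G b → a = b)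
    (hB : ∀ l p, G.Adj l p → Lf G l → ¬ Le2 (G.Adj p)) : ∃ C, InvB G C f := by
  classical
  obtain ⟨h1, h2, h3⟩ := hI
  let C := G.verts.filter fun v => ¬ Lf G v
  have hC : ∀ v, v ∈ C ↔ v ∈ G.verts ∧ ¬ Lf G v := fun v => Finset.mem_filter
  have hC' : ∀ x y, G.Adj x y → (x ∈ C ↔ ¬ Lf G x) := fun x y h => by
    rw [hC]; exact ⟨fun h => h.2, fun h' => ⟨adj_mem h, h'⟩⟩
  have hC'' : ∀ x y, G.Adj x y → (y ∈ C ↔ ¬ Lf G y) := fun x y h => hC' y x (adj_symm h)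
  have two : ∀ v ∈ C, ∃ a b, a ∈ C ∧ b ∈ C ∧ a ≠ b ∧ G.Adj v a ∧ G.Adj v b := by
    intro v hv
    have hv' := ((hC v).1 hv).2
    by_cases hl : ∃ l, G.Adj v l ∧ Lf G l
    · obtain ⟨l, hvl, hl⟩ := hl
      have := hB l v (adj_symm hvl) hl
      unfold Le2 at this
      push Not at this
      obtain ⟨a, b, c, ha, hb, hc, hab, hac, hbc⟩ := this
      have ka := hA v l a hvl ha hl
      have kb := hA v l b hvl hb hl
      have kc := hA v l c hvl hc hl
      have ea := hC'' v a ha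
      have eb := hC'' v b hb
      have ec := hC'' v c hc
      by_cases h : l = a
      · exact ⟨b, c, by grind, by grind, hbc, hb, hc⟩
      · by_cases h : l = b
        · exact ⟨a, c, by grind, by grind, hac, ha, hc⟩
        · exact ⟨a, b, by grind, by grind, hab, ha, hb⟩
    · unfold Lf at hv'
      push Not at hv'
      obtain ⟨a, b, ha, hb, hab⟩ := hv'
      push Not at hl
      exact ⟨a, b, (hC'' v a ha).2 (hl a ha), (hC'' v b hb).2 (hl b hb), hab, ha, hb⟩
  have surj : ∀ v ∈ C, ∃ u ∈ C, f u = v := by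
    intro v hv
    obtain ⟨a, b, ha, hb, hab, hva, hvb⟩ := two v hv
    have ka := h1 v a hva
    have kb := h1 v b hvb
    by_cases h : f a = v
    · exact ⟨a, ha, h⟩
    · exact ⟨b, hb, by grind⟩
  have hsub : C ⊆ C.image f := by
    intro v hv
    obtain ⟨u, hu, h⟩ := surj v hv
    exact Finset.mem_image.2 ⟨u, hu, h⟩
  have heq : C = C.image f := Finset.eq_of_subset_of_card_le hsub Finset.card_image_le
  have inj : Set.InjOn f C := Finset.card_image_iff.1 (by rw [← heq])
  have maps : ∀ v ∈ C, f v ∈ C := fun v hv => by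
    rw [heq]; exact Finset.mem_image_of_mem f hv
  refine ⟨C, maps, fun u hu v hv h => inj hu hv h, surj, ?_, ?_, ?_, ?_, ?_, ?_⟩
  · intro v hv hfv
    obtain ⟨a, b, ha, hb, hab, hva, hvb⟩ := two v hv
    have ka := h1 v a hva
    have kb := h1 v b hvb
    have na := adj_ne hva
    have nb := adj_ne hvb
    have fa : f a = v := by grind
    have fb : f b = v := by grind
    exact hab (inj ha hb (fa.trans fb.symm))
  · intro x y _ _ h
    exact h1 x y h
  · intro x y hx hy h
    have hx' : Lf G x := by have := hC' x y h; tauto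
    have hy' : Lf G y := by have := hC'' x y h; tauto
    exact hB x y h hx' fun a b c ha hb hc => Or.inl (hy' a b ha hb)
  · intro l x y hl hx hy
    have hl' : Lf G l := by have := hC' l x hx; tauto
    exact hl' x y hx hy
  · intro v a b hv ha hb hva hvb
    have ha' : Lf G a := by have := hC'' v a hva; tauto
    have hb' : Lf G b := by have := hC'' v b hvb; tauto
    exact hA v a b hva hvb ha' hb'
  · intro v l hv hl hvl hred
    have := h2 _ _ hred
    have := (hC v).1 hv
    have := (hC _).1 (maps v hv)
    tauto

theorem phaseA [Finite V] (n : ℕ) : ∀ G : Trigraph V, G.verts.card = n + 1 →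
    ∀ f, InvA G f → Good G := by
  induction n with
  | zero =>
    intro G hG f hI
    exact Good.done G hG fun v => redDeg_iff.2 (hI.deg v)
  | succ n ih =>
    intro G hG f hI
    have hr : ∀ v, G.redDeg v ≤ 2 := fun v => redDeg_iff.2 (hI.deg v)
    obtain ⟨h1, h2, h3⟩ := id hI
    by_cases hA : ∀ q a b, G.Adj q a → G.Adj q b → Lf G a → Lf G b → a = b
    · by_cases hB : ∀ l p, G.Adj l p → Lf G l → ¬ Le2 (G.Adj p)
      · obtain ⟨C, hC⟩ := phaseA_end hI hA hB
        exact phaseB (n + 1) G hG C f hC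
      · push Not at hB
        obtain ⟨l, p, hlp, hl, hp⟩ := hB
        have hpl := adj_symm hlp
        refine Good.step G p l (adj_mem hpl) (adj_mem hlp) (adj_ne hpl) hr (ih _ ?_ f ?_)
        · have := contract_card (G := G) (u := p) (adj_mem hlp); omega
        have a1 : ∀ x y, (G.contract p l).Adj x y → x ≠ l ∧ y ≠ l ∧ G.Adj x y := by
          intro x y h
          have := contract_adj h
          have : G.Adj p x → G.Adj x p := adj_symm
          unfold Lf at hl
          grind
        have lf1 : ∀ x, Lf G x → Lf (G.contract p l) x := fun x hx y z hy hz =>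
          hx y z (a1 _ _ hy).2.2 (a1 _ _ hz).2.2
        have lfp : Lf (G.contract p l) p := by
          intro y z hy hz
          have := a1 _ _ hy
          have := a1 _ _ hz
          have := hp l y z hpl
          grind
        have r1 : ∀ x y, (G.contract p l).Red x y → G.Red x y ∨ x = p ∨ y = p := by
          intro x y h
          have := contract_red h
          grind
        refine ⟨fun x y h => h1 x y (a1 x y h).2.2, ?_, ?_⟩
        · intro x y h
          rcases r1 x y h with h | rfl | rfl
          · exact (h2 x y h).imp (lf1 x) (lf1 y)
          · exact Or.inl lfp
          · exact Or.inr lfp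
        · intro x a b c ha hb hc
          by_cases hx : Lf (G.contract p l) x
          · exact Or.inl (hx a b (red_adj ha) (red_adj hb))
          · have k : ∀ z, (G.contract p l).Red x z → z = p ∨ (G.Adj x z ∧ Lf G z) := by
              intro z hz
              rcases r1 x z hz with h | rfl | rfl
              · rcases h2 x z h with h' | h'
                · exact absurd (lf1 x h') hx
                · exact Or.inr ⟨red_adj h, h'⟩
              · exact absurd lfp hx
              · exact Or.inl rfl
            have ka := k a ha
            have kb := k b hb
            have kc := k c hc
            have e := hA x
            grind
    · push Not at hA
      obtain ⟨q, l, m, hql, hqm, hl, hm, hlm⟩ := hA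
      have hlq := adj_symm hql
      have hmq := adj_symm hqm
      refine Good.step G l m (adj_mem hlq) (adj_mem hmq) hlm hr (ih _ ?_ f ?_)
      · have := contract_card (G := G) (u := l) (adj_mem hmq); omega
      have el : ∀ z, G.Adj l z → z = q := fun z hz => hl z q hz hlq
      have em : ∀ z, G.Adj m z → z = q := fun z hz => hm z q hz hmq
      have a1 : ∀ x y, (G.contract l m).Adj x y → x ≠ m ∧ y ≠ m ∧ G.Adj x y := by
        intro x y h
        have := contract_adj h
        grind
      have lf1 : ∀ x, Lf G x → Lf (G.contract l m) x := fun x hx y z hy hz =>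
        hx y z (a1 _ _ hy).2.2 (a1 _ _ hz).2.2
      have r1 : ∀ x y, (G.contract l m).Red x y → x = l ∨ (y = l ∧ x = q ∧ (G.Red q l ∨ G.Red q m))
          ∨ (x ≠ l ∧ y ≠ l ∧ y ≠ m ∧ G.Red x y) := by
        intro x y h
        have := contract_red h
        have := a1 _ _ (red_adj h)
        have : G.Red l q → G.Red q l := G.red_symm _ _
        have : G.Red m q → G.Red q m := G.red_symm _ _
        grind
      refine ⟨fun x y h => h1 x y (a1 x y h).2.2, ?_, ?_⟩
      · intro x y h
        rcases r1 x y h with rfl | ⟨rfl, _⟩ | h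
        · exact Or.inl (lf1 _ hl)
        · exact Or.inr (lf1 _ hl)
        · exact (h2 x y h.2.2.2).imp (lf1 x) (lf1 y)
      · intro x a b c ha hb hc
        by_cases hx : Lf (G.contract l m) x
        · exact Or.inl (hx a b (red_adj ha) (red_adj hb))
        · have hxl : x ≠ l := by rintro rfl; exact hx (lf1 _ hl)
          have k : ∀ z, (G.contract l m).Red x z →
              ∃ z', G.Red x z' ∧ z = if z' = m then l else z' := by
            intro z hz
            rcases r1 x z hz with h | ⟨rfl, rfl, h | h⟩ | h
            · exact absurd h hxl
            · exact ⟨z, h, by simp⟩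
            · exact ⟨m, h, by simp⟩
            · exact ⟨z, h.2.2.2, by simp [h.2.2.1]⟩
          obtain ⟨a', ha', rfl⟩ := k a ha
          obtain ⟨b', hb', rfl⟩ := k b hb
          obtain ⟨c', hc', rfl⟩ := k c hc
          rcases h3 x a' b' c' ha' hb' hc' with h | h | h <;> simp [h]


/-! Orientation -/

theorem tree_orient {W : Type*} {T : SimpleGraph W} (hT : T.IsTree) (r : W) :
    ∃ f : W → W, ∀ x y, T.Adj x y → (x ≠ r ∧ f x = y) ∨ (y ≠ r ∧ f y = x) := by
  classical
  choose p hp hp' using fun w => hT.existsUnique_path w r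
  refine ⟨fun w => (p w).snd, fun x y h => ?_⟩
  by_cases hx : x ∈ (p y).support
  · refine Or.inr ⟨?_, ?_⟩
    · rintro rfl
      have h0 := hp' y SimpleGraph.Walk.nil SimpleGraph.Walk.IsPath.nil
      rw [← h0] at hx
      simp at hx
      exact h.ne hx
    · exact (hT.isAcyclic.eq_snd_of_adj_start (hp y) h.symm hx).symm
  · refine Or.inl ⟨?_, ?_⟩
    · rintro rfl
      exact hx (SimpleGraph.Walk.end_mem_support _)
    · have := hp' x (SimpleGraph.Walk.cons h (p y)) ((hp y).cons hx)
      simp only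
      rw [← this]
      simp

theorem conn_orient {W : Type*} [Finite W] {H : SimpleGraph W} (hH : H.Connected)
    (hc : H.edgeSet.ncard ≤ Nat.card W) :
    ∃ f : W → W, ∀ x y, H.Adj x y → f x = y ∨ f y = x := by
  classical
  have := Fintype.ofFinite W
  obtain ⟨T, hTH, hT⟩ := hH.exists_isTree_le
  have h1 := hT.card_edgeFinset
  have h2 : T.edgeSet.ncard = T.edgeFinset.card := by
    rw [← SimpleGraph.coe_edgeFinset, Set.ncard_coe_finset]
  have hsub : T.edgeSet ⊆ H.edgeSet := SimpleGraph.edgeSet_mono hTH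
  have h3 := Set.ncard_diff_add_ncard_of_subset hsub (Set.toFinite _)
  rw [Nat.card_eq_fintype_card] at hc
  have h4 : (H.edgeSet \ T.edgeSet).ncard ≤ 1 := by omega
  rw [Set.ncard_le_one_iff_eq (Set.toFinite _)] at h4
  have key : ∀ r s : W, (∀ x y, H.Adj x y → ¬ T.Adj x y → s(x, y) = s(r, s)) →
      ∃ f : W → W, ∀ x y, H.Adj x y → f x = y ∨ f y = x := by
    intro r s hrs
    obtain ⟨f, hf⟩ := tree_orient hT r
    refine ⟨Function.update f r s, fun x y hxy => ?_⟩
    by_cases hTxy : T.Adj x y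
    · rcases hf x y hTxy with ⟨h, h'⟩ | ⟨h, h'⟩
      · left; rw [Function.update_of_ne h]; exact h'
      · right; rw [Function.update_of_ne h]; exact h'
    · have := hrs x y hxy hTxy
      rw [Sym2.eq_iff] at this
      rcases this with ⟨rfl, rfl⟩ | ⟨rfl, rfl⟩ <;> simp
  rcases h4 with h4 | ⟨e, h4⟩
  · obtain ⟨r⟩ := hH.nonempty
    refine key r r fun x y h h' => ?_
    have : s(x, y) ∈ H.edgeSet \ T.edgeSet := ⟨h, h'⟩
    rw [h4] at this
    exact this.elim
  · induction e with | _ r s =>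
    refine key r s fun x y h h' => ?_
    have : s(x, y) ∈ H.edgeSet \ T.edgeSet := ⟨h, h'⟩
    rw [h4] at this
    exact this

theorem orient [Fintype V] (G : SimpleGraph V)
    (h : ∀ c : G.ConnectedComponent,
      {e : Sym2 V | e ∈ G.edgeSet ∧ ∀ v ∈ e, v ∈ c.supp}.ncard ≤ c.supp.ncard) :
    ∃ f : V → V, ∀ x y, G.Adj x y → f x = y ∨ f y = x := by
  classical
  have H : ∀ c : G.ConnectedComponent, ∃ f : V → V,
      ∀ x y, x ∈ c.supp → y ∈ c.supp → G.Adj x y → f x = y ∨ f y = x := by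
    intro c
    have hc : (c.toSimpleGraph).edgeSet.ncard ≤ Nat.card c := by
      refine le_trans ?_ (h c)
      refine Set.ncard_le_ncard_of_injOn (Sym2.map Subtype.val) ?_
        ((Sym2.map.injective Subtype.val_injective).injOn) (Set.toFinite _)
      intro e he
      induction e with | _ a b =>
      refine ⟨?_, ?_⟩
      · exact c.toSimpleGraph_hom.map_adj he
      · intro v hv
        simp only [Sym2.map_mk, Sym2.mem_iff] at hv
        rcases hv with rfl | rfl
        · exact a.2
        · exact b.2
    obtain ⟨f, hf⟩ := conn_orient c.connected_toSimpleGraph hc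
    refine ⟨fun x => if hx : x ∈ c.supp then (f ⟨x, hx⟩).1 else x, fun x y hx hy hxy => ?_⟩
    have := hf ⟨x, hx⟩ ⟨y, hy⟩ hxy
    simp only [hx, hy, dif_pos]
    exact this.imp (fun h => congrArg Subtype.val h) (fun h => congrArg Subtype.val h)
  choose F hF using H
  refine ⟨fun x => F (G.connectedComponentMk x) x, fun x y hxy => ?_⟩
  have e : G.connectedComponentMk x = G.connectedComponentMk y :=
    SimpleGraph.ConnectedComponent.sound hxy.reachable
  have := hF (G.connectedComponentMk x) x y rfl e.symm hxy
  simpa [← e] using this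

theorem main [Fintype V] (G : SimpleGraph V)
    (h : ∀ c : G.ConnectedComponent,
      {e : Sym2 V | e ∈ G.edgeSet ∧ ∀ v ∈ e, v ∈ c.supp}.ncard ≤ c.supp.ncard) :
    G.tww ≤ 2 := by
  obtain ⟨f, hf⟩ := orient G h
  rcases isEmpty_or_nonempty V with hV | hV
  · have : {d : ℕ | ∃ L : List (V × V), G.toTrigraph.ValidSeq L ∧
        (G.toTrigraph.applySeq L).verts.card = 1 ∧
        ∀ L' : List (V × V), L' <+: L → ∀ v, (G.toTrigraph.applySeq L').redDeg v ≤ d} = ∅ := by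
      ext d
      simp only [Set.mem_setOf_eq, Set.mem_empty_iff_false, iff_false]
      rintro ⟨L, _, hL, _⟩
      rw [Finset.eq_empty_of_isEmpty (Trigraph.applySeq _ L).verts] at hL
      simp at hL
    unfold SimpleGraph.tww Trigraph.tww
    rw [this]
    simp
  · have hc : 0 < G.toTrigraph.verts.card := Finset.card_pos.2 Finset.univ_nonempty
    refine (phaseA (G.toTrigraph.verts.card - 1) G.toTrigraph (by omega) f ⟨?_, ?_, ?_⟩).tww_le
    · rintro x y (h | h)
      · exact hf x y h
      · exact h.elim
    · intro x y h
      exact h.elim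
    · intro x a b c h
      exact h.elim

end TwwAux

/-- **Proposition 6.5.** If every connected component of a graph `G` contains at most one
cycle (equivalently, has at most as many edges as vertices), then `tww(G) ≤ 2`. -/
theorem tww_le_two_of_unicyclic {V : Type*} [Fintype V] [DecidableEq V]
    (G : SimpleGraph V)
    (h : ∀ c : G.ConnectedComponent,
      {e : Sym2 V | e ∈ G.edgeSet ∧ ∀ v ∈ e, v ∈ c.supp}.ncard ≤ c.supp.ncard) :
    G.tww ≤ 2 := by
  exact TwwAux.main G h
end

section
/- For every tree T, the twin-width of T is at most 1 if and only if T is a caterpillar. -/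
/-- Adjacency of the spider with centre `0`, middle vertices `1, 2, 3` and leaves `4, 5, 6`;
the number is the adjacency matrix read as a bit string. -/
def sAdj (x y : Fin 7) : Bool := Nat.beq (Nat.land (Nat.shiftRight 35322484770958 (x.val * 7 + y.val)) 1) 1

def gK (k : Fin 4) (x : Fin 7) : Fin 7 :=
  ⟨cond (Nat.beq k.val 0) x.val (cond (Nat.beq x.val (k.val + 3)) k.val x.val), by
    cases Nat.beq k.val 0 <;> cases Nat.beq x.val (k.val + 3) <;> simp <;> omega⟩

def gM (g : Fin 7 → Fin 7) (i j x : Fin 7) : Fin 7 := if g x = g j then g i else g x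

def anyF (p : Fin 7 → Bool) : Bool :=
  p 0 || (p 1 || (p 2 || (p 3 || (p 4 || (p 5 || p 6)))))

def allF (p : Fin 7 → Bool) : Bool :=
  p 0 && (p 1 && (p 2 && (p 3 && (p 4 && (p 5 && p 6)))))

theorem anyF_iff (p : Fin 7 → Bool) : anyF p = true ↔ ∃ x, p x = true := by
  simp [anyF, Fin.exists_fin_succ]

theorem allF_iff (p : Fin 7 → Bool) : allF p = true ↔ ∀ x, p x = true := by
  simp [allF, Fin.forall_fin_succ]

def eqF (x y : Fin 7) : Bool := Nat.beq x.val y.val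

theorem eqF_iff (x y : Fin 7) : eqF x y = true ↔ x = y := by
  simp [eqF, Fin.ext_iff]

def sRedB (g : Fin 7 → Fin 7) (x y : Fin 7) : Bool :=
  !eqF (g x) (g y) &&
  (anyF fun x1 => eqF (g x1) (g x) && anyF fun y1 => eqF (g y1) (g y) && sAdj x1 y1) &&
  (anyF fun x1 => eqF (g x1) (g x) && anyF fun y1 => eqF (g y1) (g y) && !sAdj x1 y1)

def sRed (g : Fin 7 → Fin 7) (x y : Fin 7) : Prop :=
  g x ≠ g y ∧ (∃ x1, g x1 = g x ∧ ∃ y1, g y1 = g y ∧ sAdj x1 y1 = true) ∧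
    (∃ x1, g x1 = g x ∧ ∃ y1, g y1 = g y ∧ sAdj x1 y1 = false)

theorem sRedB_iff (g : Fin 7 → Fin 7) (x y : Fin 7) : sRedB g x y = true ↔ sRed g x y := by
  simp only [sRedB, sRed, Bool.and_eq_true, Bool.not_eq_true', anyF_iff, eqF_iff,
    ← Bool.not_eq_true, and_assoc, ne_eq]

def goodB (g : Fin 7 → Fin 7) (k : Fin 4) : Bool :=
  allF fun x => allF fun y => (eqF (g x) (g y)) == (eqF (gK k x) (gK k y))

def badB (g : Fin 7 → Fin 7) (x : Fin 7) : Bool :=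
  anyF fun y => sRedB g x y && anyF fun z => !eqF (g y) (g z) && sRedB g x z

def chkB (k : Fin 4) (i j : Fin 7) : Bool :=
  badB (gM (gK k) i j) i || badB (gM (gK k) i j) 0 ||
  (goodB (gM (gK k) i j) 0 || goodB (gM (gK k) i j) 1 ||
  goodB (gM (gK k) i j) 2 || goodB (gM (gK k) i j) 3)

def chkK (k : Fin 4) : Bool := allF fun i => allF fun j => chkB k i j

theorem chkK_all : (chkK 0 && chkK 1 && chkK 2 && chkK 3) = true := by
  decide +kernel

theorem key_check (k : Fin 4) (i j : Fin 7) :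
    (∃ k' : Fin 4, ∀ x y, gM (gK k) i j x = gM (gK k) i j y ↔ gK k' x = gK k' y) ∨
    ∃ x y, sRed (gM (gK k) i j) x y ∧ ∃ z, sRed (gM (gK k) i j) x z ∧
      gM (gK k) i j y ≠ gM (gK k) i j z := by
  have h : chkK k = true := by
    have := chkK_all
    simp only [Bool.and_eq_true] at this
    fin_cases k <;> simp_all
  have h : chkB k i j = true := (allF_iff _).1 ((allF_iff _).1 h i) j
  have hg : ∀ k', goodB (gM (gK k) i j) k' = true →
      ∀ x y, gM (gK k) i j x = gM (gK k) i j y ↔ gK k' x = gK k' y := by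
    intro k' h x y
    have := (allF_iff _).1 ((allF_iff _).1 h x) y
    rw [beq_iff_eq] at this
    rw [← eqF_iff, ← eqF_iff, this]
  have hb : ∀ x, badB (gM (gK k) i j) x = true → ∃ x y, sRed (gM (gK k) i j) x y ∧
      ∃ z, sRed (gM (gK k) i j) x z ∧ gM (gK k) i j y ≠ gM (gK k) i j z := by
    intro x h
    obtain ⟨y, hy⟩ := (anyF_iff _).1 h
    rw [Bool.and_eq_true, sRedB_iff] at hy
    obtain ⟨z, hz⟩ := (anyF_iff _).1 hy.2
    rw [Bool.and_eq_true, sRedB_iff, Bool.not_eq_true', ← Bool.not_eq_true, eqF_iff] at hz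
    exact ⟨x, y, hy.1, z, hz.2, hz.1⟩
  simp only [chkB, Bool.or_eq_true] at h
  rcases h with (h | h) | ((h | h) | h) | h
  · exact Or.inr (hb _ h)
  · exact Or.inr (hb _ h)
  all_goals exact Or.inl ⟨_, hg _ h⟩

section
variable {V : Type*} [DecidableEq V]

def TwInv (T : SimpleGraph V) (H : Trigraph V) (φ : V → V) : Prop :=
  (∀ x, φ x ∈ H.verts) ∧ ∀ x y, φ x ≠ φ y →
    (T.Adj x y → H.Adj (φ x) (φ y)) ∧ (¬ T.Adj x y → ¬ H.Black (φ x) (φ y))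

theorem TwInv.step {T : SimpleGraph V} {H : Trigraph V} {φ : V → V} (h : TwInv T H φ)
    {u v : V} (hu : u ∈ H.verts) (huv : u ≠ v) :
    TwInv T (H.contract u v) (fun x => if φ x = v then u else φ x) := by
  obtain ⟨h1, h2⟩ := h
  have key : ∀ x, (if φ x = v then u else φ x) ∈ H.verts.erase v := by
    intro x
    have := h1 x
    split_ifs <;> simp_all
  refine ⟨key, ?_⟩
  intro x y hne
  have kx := key x
  have ky := key y
  have h2xy := h2 x y
  have h2yx := h2 y x
  have cl := T.adj_comm x y
  have bs := H.black_symm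
  have rs := H.red_symm
  dsimp only at hne ⊢
  simp only [Trigraph.Adj, Trigraph.contract] at *
  constructor
  · intro ha
    by_cases e1 : φ x = v <;> by_cases e2 : φ y = v <;> 
      simp only [e1, e2, if_true, if_false] at * <;> grind
  · intro ha
    by_cases e1 : φ x = v <;> by_cases e2 : φ y = v <;> 
      simp only [e1, e2, if_true, if_false] at * <;> grind

theorem redDeg_le_one [Finite V] {H : Trigraph V} {a b c : V} (h : H.redDeg a ≤ 1)
    (hb : H.Red a b) (hc : H.Red a c) : b = c := by
  unfold Trigraph.redDeg at h
  exact (Set.ncard_le_one (Set.toFinite _)).1 h b hb c hc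

theorem TwInv.good_step [Finite V] {T : SimpleGraph V} {H : Trigraph V} {φ : V → V}
    (h : TwInv T H φ) {s : Fin 7 → V} (hs : ∀ x y, T.Adj (s x) (s y) ↔ sAdj x y = true)
    {u v : V} (hu : u ∈ H.verts) (huv : u ≠ v)
    (hd : ∀ w, (H.contract u v).redDeg w ≤ 1)
    (hg : ∃ k, ∀ x y, φ (s x) = φ (s y) ↔ gK k x = gK k y) :
    ∃ k, ∀ x y, (if φ (s x) = v then u else φ (s x)) = (if φ (s y) = v then u else φ (s y)) ↔
      gK k x = gK k y := by
  obtain ⟨k, hk⟩ := hg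
  have hI := h.step hu huv
  by_cases hj : ∃ j, φ (s j) = v
  · obtain ⟨j, rfl⟩ := hj
    by_cases hi : ∃ i, φ (s i) = u
    · obtain ⟨i, rfl⟩ := hi
      have hm : ∀ x y, (if φ (s x) = φ (s j) then φ (s i) else φ (s x)) =
          (if φ (s y) = φ (s j) then φ (s i) else φ (s y)) ↔
          gM (gK k) i j x = gM (gK k) i j y := by
        intro x y
        unfold gM
        simp only [hk]
        split_ifs <;> simp [hk]
      have hr : ∀ x y, sRed (gM (gK k) i j) x y → (H.contract (φ (s i)) (φ (s j))).Red
          (if φ (s x) = φ (s j) then φ (s i) else φ (s x))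
          (if φ (s y) = φ (s j) then φ (s i) else φ (s y)) := by
        rintro x y ⟨hne, ⟨x1, ex1, y1, ey1, a1⟩, ⟨x2, ex2, y2, ey2, a2⟩⟩
        rw [← hm] at ex1 ey1 ex2 ey2
        have hne' : ¬ _ := fun q => hne ((hm x y).1 q)
        have p1 := (hI.2 (s x1) (s y1))
        have p2 := (hI.2 (s x2) (s y2))
        dsimp only at p1 p2
        rw [ex1, ey1] at p1
        rw [ex2, ey2] at p2
        have q1 := (p1 hne').1 ((hs _ _).2 a1)
        have q2 := (p2 hne').2 (by rw [hs]; simp [a2])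
        exact q1.resolve_left q2
      rcases key_check k i j with ⟨k', hk'⟩ | ⟨x, y, r1, z, r2, hyz⟩
      · exact ⟨k', fun x y => (hm x y).trans (hk' x y)⟩
      · exact absurd ((hm y z).1 (redDeg_le_one (hd _) (hr _ _ r1) (hr _ _ r2))) hyz
    · refine ⟨k, fun x y => ?_⟩
      rw [← hk]
      push Not at hi
      have := hi x
      have := hi y
      grind
  · refine ⟨k, fun x y => ?_⟩
    rw [← hk]
    push Not at hj
    simp [hj]

theorem lower_seq [Finite V] {T : SimpleGraph V} {s : Fin 7 → V}
    (hs : ∀ x y, T.Adj (s x) (s y) ↔ sAdj x y = true) (L : List (V × V)) :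
    ∀ (H : Trigraph V) (φ : V → V), TwInv T H φ →
    (∃ k, ∀ x y, φ (s x) = φ (s y) ↔ gK k x = gK k y) → H.ValidSeq L →
    (∀ L' : List (V × V), L' <+: L → ∀ v, (H.applySeq L').redDeg v ≤ 1) →
    (H.applySeq L).verts.card ≠ 1 := by
  induction L with
  | nil =>
    intro H φ hI hg _ _ hc
    obtain ⟨k, hk⟩ := hg
    have hc : H.verts.card = 1 := hc
    obtain ⟨a, ha⟩ := Finset.card_eq_one.1 hc
    have h1 : ∀ x, φ x = a := fun x => by have := hI.1 x; rw [ha] at this; simpa using this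
    have := (hk 0 1).1 (by rw [h1, h1])
    clear hk
    revert this
    revert k
    decide
  | cons p L ih =>
    intro H φ hI hg hv hp
    obtain ⟨hu, hv', hne, hV⟩ := hv
    refine ih (H.contract p.1 p.2) _ (hI.step hu hne) ?_ hV ?_
    · exact hI.good_step hs hu hne (hp [p] (by simp)) hg
    · intro L' hL' v
      exact hp (p :: L') (by simpa using hL') v

theorem exists_seq (n : ℕ) : ∀ (H : Trigraph V), H.verts.card = n + 1 →
    ∃ L, H.ValidSeq L ∧ (H.applySeq L).verts.card = 1 := by
  induction n with
  | zero => intro H h; exact ⟨[], trivial, h⟩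
  | succ n ih =>
    intro H h
    obtain ⟨a, ha, b, hb, hab⟩ := Finset.one_lt_card.1 (show 1 < H.verts.card by omega)
    obtain ⟨L, h1, h2⟩ := ih (H.contract a b) (by
      show (H.verts.erase b).card = _
      rw [Finset.card_erase_of_mem hb]; omega)
    exact ⟨(a, b) :: L, ⟨ha, hb, hab, h1⟩, h2⟩

theorem no_spider [Fintype V] [Nonempty V] {T : SimpleGraph V} (ht : T.tww ≤ 1) {s : Fin 7 → V}
    (hinj : Function.Injective s)
    (hs : ∀ x y, T.Adj (s x) (s y) ↔ sAdj x y = true) : False := by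
  have hne : {d : ℕ | ∃ L : List (V × V), T.toTrigraph.ValidSeq L ∧
      (T.toTrigraph.applySeq L).verts.card = 1 ∧
      ∀ L' : List (V × V), L' <+: L → ∀ v, (T.toTrigraph.applySeq L').redDeg v ≤ d}.Nonempty := by
    obtain ⟨L, h1, h2⟩ := exists_seq (Fintype.card V - 1) T.toTrigraph (by
      have : 0 < Fintype.card V := Fintype.card_pos
      show (Finset.univ : Finset V).card = _
      rw [Finset.card_univ]; omega)
    refine ⟨Nat.card V, L, h1, h2, fun L' _ v => ?_⟩
    exact Set.ncard_le_card _
  have hm := Nat.sInf_mem hne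
  obtain ⟨L, h1, h2, h3⟩ := hm
  refine lower_seq hs L T.toTrigraph id ?_ ?_ h1 (fun L' hL' v => (h3 L' hL' v).trans ht) h2
  · refine ⟨fun x => Finset.mem_univ _, fun x y hxy => ⟨fun h => Or.inl h, fun h => h⟩⟩
  · refine ⟨0, fun x y => ?_⟩
    simp [gK, hinj.eq_iff, Nat.beq]

structure AccInv (T : SimpleGraph V) (H : Trigraph V) (A : Finset V) (x : V) : Prop where
  mem : x ∈ A
  verts : ∀ v, v ∈ H.verts ↔ v = x ∨ v ∉ A
  red : ∀ u v, H.Red u v → u = x ∨ v = x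
  adj : ∀ v, H.Adj x v → ∃ a ∈ A, T.Adj a v
  adj' : ∀ u v, u ≠ x → v ≠ x → H.Adj u v → T.Adj u v

theorem AccInv.red_le [Finite V] {T : SimpleGraph V} {H : Trigraph V} {A : Finset V} {x : V}
    (h : AccInv T H A x) (hp : ∃ p, ∀ a ∈ A, ∀ v ∉ A, T.Adj a v → v = p) (v : V) :
    H.redDeg v ≤ 1 := by
  unfold Trigraph.redDeg
  rw [Set.ncard_le_one (Set.toFinite _)]
  intro a ha b hb
  simp only [Set.mem_ofPred_eq] at ha hb
  obtain ⟨p, hp⟩ := hp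
  by_cases hv : v = x
  · subst hv
    have : ∀ c, H.Red v c → c = p := by
      intro c hc
      obtain ⟨a, ha, hac⟩ := h.adj c (Or.inr hc)
      have h1 := H.red_mem _ _ (H.red_symm _ _ hc)
      have h2 := H.red_ne _ _ hc
      have := ((h.verts c).1 h1).resolve_left h2.symm
      exact hp a ha c this hac
    rw [this a ha, this b hb]
  · rw [(h.red _ _ ha).resolve_left hv, (h.red _ _ hb).resolve_left hv]

theorem AccInv.step {T : SimpleGraph V} {H : Trigraph V} {A : Finset V} {x w : V}
    (h : AccInv T H A x) (hw : w ∉ A) : AccInv T (H.contract x w) (insert w A) x := by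
  have hne : x ≠ w := fun e => hw (e ▸ h.mem)
  obtain ⟨m, vv, r, a, a'⟩ := h
  have bs := H.black_symm
  have rs := H.red_symm
  refine ⟨by simp [m], ?_, ?_, ?_, ?_⟩
  · intro v
    simp only [Trigraph.contract, Finset.mem_erase, vv, Finset.mem_insert]
    grind
  · intro u v
    simp only [Trigraph.contract]
    grind
  · intro v hv
    have ha := a v
    have hb := a' w v
    simp only [Trigraph.contract, Trigraph.Adj] at *
    grind
  · intro u v
    have := a' u v
    simp only [Trigraph.contract, Trigraph.Adj] at *
    grind

theorem acc_seq [Fintype V] {T : SimpleGraph V} (F : Finset V → Prop)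
    (hF1 : ∀ A, F A → ∃ p, ∀ a ∈ A, ∀ v ∉ A, T.Adj a v → v = p)
    (hF2 : ∀ A, F A → A ≠ Finset.univ → ∃ v, v ∉ A ∧ F (insert v A)) (x : V) (n : ℕ) :
    ∀ (H : Trigraph V) (A : Finset V), A.card + n = Fintype.card V → F A → AccInv T H A x →
    ∃ L : List (V × V), H.ValidSeq L ∧ (H.applySeq L).verts.card = 1 ∧
      ∀ L' : List (V × V), L' <+: L → ∀ v, (H.applySeq L').redDeg v ≤ 1 := by
  induction n with
  | zero =>
    intro H A hc hA hI
    have hu : A = Finset.univ := (Finset.card_eq_iff_eq_univ A).1 (by omega)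
    refine ⟨[], trivial, ?_, ?_⟩
    · show H.verts.card = 1
      rw [Finset.card_eq_one]
      refine ⟨x, ?_⟩
      ext v
      simp [hI.verts, hu]
    · intro L' hL' v
      rw [List.prefix_nil] at hL'
      subst hL'
      exact hI.red_le (hF1 A hA) v
  | succ n ih =>
    intro H A hc hA hI
    have hu : A ≠ Finset.univ := by
      rintro rfl
      rw [Finset.card_univ] at hc
      omega
    obtain ⟨w, hw, hFw⟩ := hF2 A hA hu
    obtain ⟨L, h1, h2, h3⟩ := ih (H.contract x w) (insert w A)
      (by rw [Finset.card_insert_of_notMem hw]; omega) hFw (hI.step hw)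
    refine ⟨(x, w) :: L, ⟨(hI.verts x).2 (Or.inl rfl), (hI.verts w).2 (Or.inr hw),
      fun e => hw ((show x = w from e) ▸ hI.mem), h1⟩, h2, ?_⟩
    intro L' hL' v
    cases L' with
    | nil => exact hI.red_le (hF1 A hA) v
    | cons q L' =>
      rw [List.cons_prefix_cons] at hL'
      obtain ⟨rfl, hL'⟩ := hL'
      exact h3 L' hL' v

theorem tww_le_of_family [Fintype V] [Nonempty V] {T : SimpleGraph V} (F : Finset V → Prop)
    (hF0 : F ∅)
    (hF1 : ∀ A, F A → ∃ p, ∀ a ∈ A, ∀ v ∉ A, T.Adj a v → v = p)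
    (hF2 : ∀ A, F A → A ≠ Finset.univ → ∃ v, v ∉ A ∧ F (insert v A)) : T.tww ≤ 1 := by
  obtain ⟨x, -, hx⟩ := hF2 ∅ hF0 (Finset.univ_nonempty.ne_empty.symm)
  apply Nat.sInf_le
  have : 0 < Fintype.card V := Fintype.card_pos
  refine acc_seq F hF1 hF2 x (Fintype.card V - 1) T.toTrigraph (insert x ∅)
    (by simp; omega) hx ⟨by simp, ?_, ?_, ?_, ?_⟩
  · intro v; simp [SimpleGraph.toTrigraph, em]
  · intro u v h; exact h.elim
  · intro v h
    exact ⟨x, by simp, h.resolve_right id⟩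
  · intro u v _ _ h
    exact h.resolve_right id

end

section
variable {V : Type*}

theorem path_len_of_adj {T : SimpleGraph V} (hT : T.IsAcyclic) {a b : V} {p : T.Walk a b}
    (hp : p.IsPath) (h : T.Adj a b) : p.length = 1 := by
  have := hT.path_unique ⟨p, hp⟩ (SimpleGraph.Path.singleton h)
  have h2 := congrArg (fun q : T.Path a b => q.1.length) this
  simpa [SimpleGraph.Path.singleton] using h2

def spiderG : SimpleGraph (Fin 7) where
  Adj x y := sAdj x y = true
  symm := ⟨by decide⟩
  loopless := ⟨by decide⟩

theorem spider_conn : spiderG.Connected := by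
  have h0 : ∀ x, spiderG.Reachable 0 x := by
    have a : ∀ x y, sAdj x y = true → spiderG.Reachable x y :=
      fun x y h => SimpleGraph.Adj.reachable (show spiderG.Adj x y from h)
    intro x
    fin_cases x
    · exact SimpleGraph.Reachable.refl _
    · exact a 0 1 (by decide)
    · exact a 0 2 (by decide)
    · exact a 0 3 (by decide)
    · exact (a 0 1 (by decide)).trans (a 1 4 (by decide))
    · exact (a 0 2 (by decide)).trans (a 2 5 (by decide))
    · exact (a 0 3 (by decide)).trans (a 3 6 (by decide))
  exact ⟨fun x y => (h0 x).symm.trans (h0 y)⟩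

theorem spider_induced {T : SimpleGraph V} (hT : T.IsAcyclic) {s : Fin 7 → V}
    (hinj : Function.Injective s) (h : ∀ x y, sAdj x y = true → T.Adj (s x) (s y)) (x y : Fin 7) :
    T.Adj (s x) (s y) ↔ sAdj x y = true := by
  refine ⟨fun hxy => ?_, h x y⟩
  let f : spiderG →g T := ⟨s, fun {a b} hab => h a b hab⟩
  obtain ⟨p, hp⟩ := spider_conn.exists_isPath x y
  have h1 := path_len_of_adj hT (SimpleGraph.Walk.IsPath.map (f := f) hinj hp) hxy
  rw [SimpleGraph.Walk.length_map] at h1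
  exact SimpleGraph.Walk.adj_of_length_eq_one h1

theorem longest_idx {T : SimpleGraph V} {u w : V} {P : T.Walk u w} (hP : P.IsPath)
    (hmax : ∀ (a b : V) (Q : T.Walk a b), Q.IsPath → Q.length ≤ P.length)
    {v1 v2 : V} {i : ℕ} (hi : i ≤ P.length) (h1 : v1 ∉ P.support) (h2 : v2 ∉ P.support)
    (ha : T.Adj v1 (P.getVert i)) (hb : T.Adj v2 v1) : 2 ≤ i := by
  by_contra hlt
  have hsub : (P.drop i).support ⊆ P.support := by
    exact (P.isSubwalk_drop i).support_subset
  have := hmax _ _ (SimpleGraph.Walk.cons hb (SimpleGraph.Walk.cons ha (P.drop i))) (by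
    rw [SimpleGraph.Walk.cons_isPath_iff, SimpleGraph.Walk.cons_isPath_iff]
    refine ⟨⟨hP.drop i, fun h => h1 (hsub h)⟩, ?_⟩
    rw [SimpleGraph.Walk.support_cons, List.mem_cons, not_or]
    exact ⟨hb.ne, fun h => h2 (hsub h)⟩)
  simp only [SimpleGraph.Walk.length_cons, SimpleGraph.Walk.drop_length] at this
  omega

theorem spider_of_longest {T : SimpleGraph V} (hT : T.IsAcyclic) {u w : V} {P : T.Walk u w}
    (hP : P.IsPath)
    (hmax : ∀ (a b : V) (Q : T.Walk a b), Q.IsPath → Q.length ≤ P.length)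
    {v1 v2 p : V} (hp : p ∈ P.support) (h1 : v1 ∉ P.support) (h2 : v2 ∉ P.support)
    (ha : T.Adj v1 p) (hb : T.Adj v2 v1) :
    ∃ s : Fin 7 → V, Function.Injective s ∧ ∀ x y, T.Adj (s x) (s y) ↔ sAdj x y = true := by
  obtain ⟨i, rfl, hi⟩ := SimpleGraph.Walk.mem_support_iff_exists_getVert.1 hp
  have hi2 := longest_idx hP hmax hi h1 h2 ha hb
  have hi3 : 2 ≤ P.length - i := by
    refine longest_idx (P := P.reverse) hP.reverse (by simpa using hmax) (by simp)
      (v1 := v1) (v2 := v2) (by simpa using h1) (by simpa using h2) ?_ hb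
    rw [SimpleGraph.Walk.getVert_reverse]
    rwa [Nat.sub_sub_self hi]
  have hinj := hP.getVert_injOn
  have hne : ∀ a b, a ≤ P.length → b ≤ P.length → (P.getVert a = P.getVert b ↔ a = b) :=
    fun a b h h' => ⟨fun e => hinj h h' e, fun e => e ▸ rfl⟩
  have hadj : ∀ a, a < P.length → T.Adj (P.getVert a) (P.getVert (a+1)) :=
    fun a h => P.adj_getVert_succ h
  have n1 : ∀ a, v1 ≠ P.getVert a := fun a e => h1 (e ▸ P.getVert_mem_support a)
  have n2 : ∀ a, v2 ≠ P.getVert a := fun a e => h2 (e ▸ P.getVert_mem_support a)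
  have n12 := hb.ne
  obtain ⟨k, rfl⟩ : ∃ k, i = k + 2 := ⟨i - 2, by omega⟩
  let s : Fin 7 → V := ![P.getVert (k+2), P.getVert (k+1), P.getVert (k+3), v1,
    P.getVert k, P.getVert (k+4), v2]
  have hsi : Function.Injective s := by
    intro x y hxy
    fin_cases x <;> fin_cases y <;> simp [s] at hxy ⊢ <;>
    first
      | (rw [hne _ _ (by omega) (by omega)] at hxy; omega)
      | exact n1 _ hxy
      | exact n2 _ hxy
      | exact n1 _ hxy.symm
      | exact n2 _ hxy.symm
      | exact n12 hxy
      | exact n12 hxy.symm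
  refine ⟨s, hsi, spider_induced hT hsi ?_⟩
  have e1 := hadj k (by omega)
  have e2 := hadj (k+1) (by omega)
  have e3 := hadj (k+2) (by omega)
  have e4 := hadj (k+3) (by omega)
  intro x y hxy
  fin_cases x <;> fin_cases y <;> first
    | (exfalso; revert hxy; decide)
    | (simp only [s]; first
        | exact e1 | exact e2 | exact e3 | exact e4 | exact ha | exact hb
        | exact e1.symm | exact e2.symm | exact e3.symm | exact e4.symm | exact ha.symm
        | exact hb.symm)

theorem exists_longest [Fintype V] [Nonempty V] (T : SimpleGraph V) :
    ∃ (u w : V) (P : T.Walk u w), P.IsPath ∧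
      ∀ (a b : V) (Q : T.Walk a b), Q.IsPath → Q.length ≤ P.length := by
  classical
  let S : Set ℕ := {n | ∃ (u w : V) (P : T.Walk u w), P.IsPath ∧ P.length = n}
  have hS : S.Nonempty := by
    obtain ⟨x⟩ := ‹Nonempty V›
    exact ⟨0, x, x, SimpleGraph.Walk.nil, by simp, rfl⟩
  have hB : BddAbove S := ⟨Fintype.card V, by
    rintro n ⟨u, w, P, hP, rfl⟩
    exact hP.length_lt.le⟩
  obtain ⟨u, w, P, hP, hl⟩ := Nat.sSup_mem hS hB
  exact ⟨u, w, P, hP, fun a b Q hQ => hl ▸ le_csSup hB ⟨a, b, Q, hQ, rfl⟩⟩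

theorem unique_attach {T : SimpleGraph V} (hT : T.IsAcyclic) {u w : V} (P : T.Walk u w)
    {v p q : V} (hv : v ∉ P.support) (hp : p ∈ P.support) (hq : q ∈ P.support)
    (ha : T.Adj v p) (hb : T.Adj v q) : p = q := by
  classical
  by_contra hne
  let W : T.Walk p q := (P.takeUntil p hp).reverse.append (P.takeUntil q hq)
  have hW : v ∉ W.bypass.support := by
    intro h
    have := W.support_bypass_subset_support h
    rw [SimpleGraph.Walk.mem_support_append_iff, SimpleGraph.Walk.support_reverse,
      List.mem_reverse] at this
    rcases this with h | h
    · exact hv (P.support_takeUntil_subset_support hp h)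
    · exact hv (P.support_takeUntil_subset_support hq h)
  have h2 : (SimpleGraph.Walk.cons ha.symm (SimpleGraph.Walk.cons hb SimpleGraph.Walk.nil)).IsPath := by
    simp [SimpleGraph.Walk.cons_isPath_iff, ha.ne', hb.ne, hne]
  have := hT.path_unique ⟨W.bypass, W.bypass_isPath⟩ ⟨_, h2⟩
  apply hW
  have h3 : W.bypass = _ := congrArg Subtype.val this
  rw [h3]
  simp

theorem cat_of_tww [Fintype V] [DecidableEq V] (T : SimpleGraph V) (hT : T.IsTree)
    (ht : T.tww ≤ 1) : ∃ (u w : V) (P : T.Walk u w), P.IsPath ∧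
      ∀ v : V, v ∉ P.support →
        ((T.neighborSet v).ncard = 1 ∧ ∀ x : V, T.Adj v x → x ∈ P.support) := by
  have : Nonempty V := hT.1.nonempty
  obtain ⟨u, w, P, hP, hmax⟩ := exists_longest T
  have hns : ∀ v1 v2 p, p ∈ P.support → v1 ∉ P.support → v2 ∉ P.support → T.Adj v1 p →
      ¬ T.Adj v2 v1 := by
    intro v1 v2 p hp h1 h2 ha hb
    obtain ⟨s, hs, hs'⟩ := spider_of_longest hT.2 hP hmax hp h1 h2 ha hb
    exact no_spider ht hs hs'
  have hcov : ∀ v, v ∈ P.support ∨ ∃ p ∈ P.support, T.Adj v p := by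
    intro v
    have hr := hT.1.preconnected u v
    rw [SimpleGraph.reachable_iff_reflTransGen] at hr
    induction hr with
    | refl => exact Or.inl P.start_mem_support
    | tail _ hbc ih =>
      rename_i b c _
      by_cases hc : c ∈ P.support
      · exact Or.inl hc
      · rcases ih with hb | ⟨p, hp, hbp⟩
        · exact Or.inr ⟨b, hb, hbc.symm⟩
        · by_cases hb : b ∈ P.support
          · exact Or.inr ⟨b, hb, hbc.symm⟩
          · exact absurd hbc.symm (hns b c p hp hb hc hbp)
  refine ⟨u, w, P, hP, fun v hv => ?_⟩
  obtain ⟨p, hp, hvp⟩ := (hcov v).resolve_left hv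
  have hall : ∀ x, T.Adj v x → x ∈ P.support := by
    intro x hx
    by_contra hxP
    exact hns v x p hp hv hxP hvp hx.symm
  refine ⟨?_, hall⟩
  rw [Set.ncard_eq_one]
  refine ⟨p, ?_⟩
  ext x
  simp only [SimpleGraph.mem_neighborSet, Set.mem_singleton_iff]
  exact ⟨fun hx => unique_attach hT.2 P hv (hall x hx) hp hx hvp, fun e => e ▸ hvp⟩

theorem getVert_adj {T : SimpleGraph V} (hT : T.IsAcyclic) {u w : V} {P : T.Walk u w}
    (hP : P.IsPath) {j k : ℕ} (hk : k ≤ P.length) (hjk : j < k)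
    (h : T.Adj (P.getVert j) (P.getVert k)) : k = j + 1 := by
  have h1 := (hP.drop j).take (k - j)
  have e : (P.drop j).getVert (k - j) = P.getVert k := by
    rw [SimpleGraph.Walk.drop_getVert]; congr 1; omega
  have := path_len_of_adj hT h1 (by rw [e]; exact h)
  rw [SimpleGraph.Walk.take_length, SimpleGraph.Walk.drop_length] at this
  omega

theorem tww_of_cat [Fintype V] [DecidableEq V] (T : SimpleGraph V) (hT : T.IsTree)
    {u w : V} (P : T.Walk u w) (hP : P.IsPath)
    (hc : ∀ v : V, v ∉ P.support →
        ((T.neighborSet v).ncard = 1 ∧ ∀ x : V, T.Adj v x → x ∈ P.support)) : T.tww ≤ 1 := by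
  have : Nonempty V := ⟨u⟩
  have hg : ∀ v, ∃ j, j ≤ P.length ∧ ((v ∈ P.support ∧ v = P.getVert j) ∨
      (v ∉ P.support ∧ ∀ x, T.Adj v x → x = P.getVert j)) := by
    intro v
    by_cases hv : v ∈ P.support
    · obtain ⟨i, e, hi⟩ := SimpleGraph.Walk.mem_support_iff_exists_getVert.1 hv
      exact ⟨i, hi, Or.inl ⟨hv, e.symm⟩⟩
    · obtain ⟨h1, h2⟩ := hc v hv
      obtain ⟨p, hp⟩ := Set.ncard_eq_one.1 h1
      have hvp : T.Adj v p := by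
        have : p ∈ T.neighborSet v := by rw [hp]; rfl
        exact this
      obtain ⟨i, e, hi⟩ := SimpleGraph.Walk.mem_support_iff_exists_getVert.1 (h2 p hvp)
      refine ⟨i, hi, Or.inr ⟨hv, fun x hx => ?_⟩⟩
      have : x ∈ T.neighborSet v := hx
      rw [hp] at this
      rw [e]; exact this
  choose g hgl hg using hg
  have hgP : ∀ j, j ≤ P.length → g (P.getVert j) = j := by
    intro j hj
    rcases hg (P.getVert j) with ⟨-, h⟩ | ⟨h, -⟩
    · exact (hP.getVert_injOn hj (hgl _) h).symm
    · exact absurd (P.getVert_mem_support j) h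
  refine tww_le_of_family (fun A => ∃ i, (∀ v, g v < i → v ∈ A) ∧ (∀ v ∈ A, g v ≤ i) ∧
    (i ≤ P.length → P.getVert i ∉ A)) ⟨0, by simp, by simp, by simp⟩ ?_ ?_
  · rintro A ⟨i, h1, h2, h3⟩
    refine ⟨P.getVert i, fun a ha v hv hav => ?_⟩
    have hvi : i ≤ g v := by
      by_contra h
      exact hv (h1 v (by omega))
    have hai := h2 a ha
    have hiP := hvi.trans (hgl v)
    have hne : a ≠ P.getVert i := fun e => h3 hiP (e ▸ ha)
    rcases hg a with ⟨-, ea⟩ | ⟨-, ea⟩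
    · have hlt : g a < i := lt_of_le_of_ne hai (fun e => hne (e ▸ ea))
      rcases hg v with ⟨-, ev⟩ | ⟨-, ev⟩
      · rw [ea, ev] at hav
        have := getVert_adj hT.2 hP (hgl v) (by omega) hav
        rw [ev]; congr 1; omega
      · have h5 := ev a hav.symm
        have h6 : g a = g v := by rw [h5]; exact hgP _ (hgl v)
        omega
    · have h5 := ea v hav
      have h6 : g v = g a := by rw [h5]; exact hgP _ (hgl a)
      rw [h5]; congr 1; omega
  · rintro A ⟨i, h1, h2, h3⟩ hA
    obtain ⟨y, hy⟩ : ∃ y, y ∉ A := by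
      by_contra h
      push Not at h
      exact hA (Finset.eq_univ_iff_forall.2 h)
    have hiP : i ≤ P.length := by
      by_contra h
      exact hy (h1 y (by have := hgl y; omega))
    by_cases hl : ∃ v, v ∉ A ∧ g v = i ∧ v ≠ P.getVert i
    · obtain ⟨v, hv, hgv, hvn⟩ := hl
      refine ⟨v, hv, i, fun z hz => Finset.mem_insert_of_mem (h1 z hz), ?_, ?_⟩
      · intro z hz
        rcases Finset.mem_insert.1 hz with rfl | hz
        · omega
        · exact h2 z hz
      · intro _ hm
        rcases Finset.mem_insert.1 hm with e | hz
        · exact hvn e.symm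
        · exact h3 hiP hz
    · push Not at hl
      refine ⟨P.getVert i, h3 hiP, i + 1, ?_, ?_, ?_⟩
      · intro z hz
        by_cases hzA : z ∈ A
        · exact Finset.mem_insert_of_mem hzA
        · have : ¬ g z < i := fun h => hzA (h1 z h)
          rw [hl z hzA (by omega)]
          exact Finset.mem_insert_self _ _
      · intro z hz
        rcases Finset.mem_insert.1 hz with rfl | hz
        · rw [hgP _ hiP]; omega
        · have := h2 z hz; omega
      · intro hi1 hm
        have hgi := hgP _ hi1
        rcases Finset.mem_insert.1 hm with e | hz
        · rw [e, hgP _ hiP] at hgi; omega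
        · have := h2 _ hz; omega

end

/-- **Lemma 6.6.** For a tree `T`, `tww(T) ≤ 1` iff `T` is a caterpillar, i.e. `T` contains
a path `P` such that every vertex outside `P` is a leaf whose unique neighbor lies on `P`. -/
theorem tww_le_one_iff_caterpillar {V : Type*} [Fintype V] [DecidableEq V]
    (T : SimpleGraph V) (hT : T.IsTree) :
    T.tww ≤ 1 ↔ ∃ (u w : V) (P : T.Walk u w), P.IsPath ∧
      ∀ v : V, v ∉ P.support →
        ((T.neighborSet v).ncard = 1 ∧ ∀ x : V, T.Adj v x → x ∈ P.support) := by
  constructor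
  · exact cat_of_tww T hT
  · rintro ⟨u, w, P, hP, hc⟩
    exact tww_of_cat T hT P hP hc
end
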